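/- Define a_0 = 20, a_j = 2^{a_{j−1}} for j ≥ 1, and E_j = (a_j)². Define ℓ_j = 4E_jE_{j−2}/E_{j−1}, b_j = E_j/E_{j−1} for j ≥ 2, ℓ_1 = E_1, and L_j = ℓ_j + ∑_{k=1}^{j−1} b_j ⋯ b_{k+1} ℓ_k (L_1 = ℓ_1). Then the series ∑_{k=2}^∞ (4E_{k−2}/E_{k−1}) · log L_k converges to a finite value C_1; moreover each summand satisfies (4E_{k−2}/E_{k−1}) log L_k ≤ (8 log 2)·(a_{k−2})²/2^{a_{k−2}} + 4 log(1+ε_0)·(a_{k−2})²/4^{a_{k−2}}, where ε_0 := 4 ∑_{k=2}^∞ E_{k−2}/E_{k−1}. -/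

import Mathlib

/-- The sequence `a_0 = 20`, `a_j = 2^{a_{j-1}}`. -/
def a : ℕ → ℕ
  | 0 => 20
  | j + 1 => 2 ^ a j

/-- `E_j = (a_j)²`. -/
def E (j : ℕ) : ℕ := a j ^ 2

/-- `ℓ_1 = E_1` and `ℓ_j = 4 E_j E_{j-2} / E_{j-1}` for `j ≥ 2`, as reals. -/
noncomputable def ell (j : ℕ) : ℝ :=
  if j = 1 then (E 1 : ℝ) else 4 * (E j : ℝ) * (E (j - 2) : ℝ) / (E (j - 1) : ℝ)

/-- `b_j = E_j / E_{j-1}`, as a real. -/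
noncomputable def b (j : ℕ) : ℝ := (E j : ℝ) / (E (j - 1) : ℝ)

/-- `L_j = ℓ_j + ∑_{k=1}^{j-1} b_j b_{j-1} ⋯ b_{k+1} ℓ_k` (so `L_1 = ℓ_1`). -/
noncomputable def Lb (j : ℕ) : ℝ :=
  ell j + ∑ k ∈ Finset.Icc 1 (j - 1), (∏ i ∈ Finset.Icc (k + 1) j, b i) * ell k

/-- `ε₀ = 4 ∑_{k=2}^∞ E_{k-2}/E_{k-1}`, written as `4 ∑_{k=0}^∞ E_k/E_{k+1}`. -/
noncomputable def eps0 : ℝ := 4 * ∑' k : ℕ, (E k : ℝ) / (E (k + 1) : ℝ)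

theorem a_succ (j : ℕ) : a (j + 1) = 2 ^ a j := rfl

theorem a_strictMono : StrictMono a :=
  strictMono_nat_of_lt_succ fun j => by
    rw [a_succ]
    exact Nat.lt_two_pow_self

theorem a_pos (j : ℕ) : 0 < a j := by
  cases j with
  | zero => norm_num [a]
  | succ j => rw [a_succ]; positivity

theorem E_pos (j : ℕ) : (0 : ℝ) < E j := by
  have := a_pos j
  unfold E
  positivity

theorem one_le_E (j : ℕ) : (1 : ℝ) ≤ E j := by
  exact_mod_cast (Nat.cast_pos.mp (E_pos j) : 0 < E j)

theorem E_succ (j : ℕ) : (E (j + 1) : ℝ) = 4 ^ a j := by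
  rw [E, a_succ]
  push_cast
  rw [← pow_mul, mul_comm, pow_mul]
  norm_num

theorem summable_sq_div_two_pow_a : Summable fun k : ℕ => (a k : ℝ) ^ 2 / 2 ^ a k := by
  have h : Summable fun n : ℕ => (n : ℝ) ^ 2 * (1 / 2 : ℝ) ^ n :=
    summable_pow_mul_geometric_of_norm_lt_one 2 (by norm_num)
  refine (h.comp_injective a_strictMono.injective).congr fun k => ?_
  simp [div_eq_mul_inv]

theorem sq_div_four_pow_le (n : ℕ) : (n : ℝ) ^ 2 / 4 ^ n ≤ (n : ℝ) ^ 2 / 2 ^ n := by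
  gcongr
  norm_num

theorem summable_sq_div_four_pow_a : Summable fun k : ℕ => (a k : ℝ) ^ 2 / 4 ^ a k :=
  summable_sq_div_two_pow_a.of_nonneg_of_le (fun _ => by positivity)
    fun k => sq_div_four_pow_le (a k)

theorem E_div_E_succ (k : ℕ) : (E k : ℝ) / E (k + 1) = (a k : ℝ) ^ 2 / 4 ^ a k := by
  rw [E_succ, E, Nat.cast_pow]

theorem summable_E_div_E_succ : Summable fun k : ℕ => (E k : ℝ) / E (k + 1) :=
  summable_sq_div_four_pow_a.congr fun k => (E_div_E_succ k).symm

theorem Lb_succ_succ (n : ℕ) : Lb (n + 2) = ell (n + 2) + b (n + 2) * Lb (n + 1) := by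
  have h : ∀ k ∈ Finset.Icc 1 n, (∏ i ∈ Finset.Icc (k + 1) (n + 2), b i) * ell k =
      b (n + 2) * ((∏ i ∈ Finset.Icc (k + 1) (n + 1), b i) * ell k) := fun k hk => by
    rw [Finset.mem_Icc] at hk
    rw [Finset.prod_Icc_succ_top (by lia)]
    ring
  simp only [Lb, Nat.add_sub_cancel, show n + 2 - 1 = n + 1 by lia]
  rw [Finset.sum_Icc_succ_top (by lia), Finset.sum_congr rfl h, ← Finset.mul_sum,
    Finset.Icc_self, Finset.prod_singleton]
  ring

/-- The closed form `L_{n+1} = E_{n+1} (1 + 4 ∑_{j<n} E_j / E_{j+1})`. -/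
theorem Lb_succ (n : ℕ) :
    Lb (n + 1) = E (n + 1) * (1 + 4 * ∑ j ∈ Finset.range n, (E j : ℝ) / E (j + 1)) := by
  induction n with
  | zero => simp [Lb, ell]
  | succ n ih =>
    have h₁ := (E_pos (n + 1)).ne'
    rw [Lb_succ_succ, ih, Finset.sum_range_succ, ell, b, if_neg (by lia)]
    simp only [Nat.add_sub_cancel, show n + 2 - 1 = n + 1 by lia]
    field_simp
    ring

theorem sum_E_div_E_succ_nonneg (n : ℕ) :
    0 ≤ ∑ j ∈ Finset.range n, (E j : ℝ) / E (j + 1) :=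
  Finset.sum_nonneg fun _ _ => by positivity

theorem one_le_Lb_succ (n : ℕ) : 1 ≤ Lb (n + 1) := by
  rw [Lb_succ]
  exact one_le_mul_of_one_le_of_one_le (one_le_E _)
    (by linarith [sum_E_div_E_succ_nonneg n])

theorem Lb_succ_le (n : ℕ) : Lb (n + 1) ≤ E (n + 1) * (1 + eps0) := by
  rw [Lb_succ, eps0]
  gcongr
  exact summable_E_div_E_succ.sum_le_tsum _ fun _ _ => by positivity

theorem eps0_nonneg : 0 ≤ eps0 :=
  mul_nonneg (by norm_num) (tsum_nonneg fun _ => by positivity)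

theorem log_Lb_add_two_le (k : ℕ) :
    Real.log (Lb (k + 2)) ≤ 2 * 2 ^ a k * Real.log 2 + Real.log (1 + eps0) := by
  have h₁ : Real.log (E (k + 2)) = 2 * 2 ^ a k * Real.log 2 := by
    rw [E, a_succ (k + 1), a_succ k, Nat.cast_pow, Nat.cast_pow, Real.log_pow, Real.log_pow]
    push_cast
    ring
  have h₂ : 1 + eps0 ≠ 0 := by linarith [eps0_nonneg]
  rw [← h₁, ← Real.log_mul (E_pos _).ne' h₂]
  exact Real.log_le_log (by linarith [one_le_Lb_succ (k + 1)]) (Lb_succ_le (k + 1))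

theorem summand_le (k : ℕ) :
    4 * (E k : ℝ) / (E (k + 1) : ℝ) * Real.log (Lb (k + 2)) ≤
      8 * Real.log 2 * (a k : ℝ) ^ 2 / 2 ^ a k +
        4 * Real.log (1 + eps0) * (a k : ℝ) ^ 2 / 4 ^ a k := by
  have h : (4 : ℝ) ^ a k = 2 ^ a k * 2 ^ a k := by rw [← mul_pow]; norm_num
  calc 4 * (E k : ℝ) / (E (k + 1) : ℝ) * Real.log (Lb (k + 2))
      ≤ 4 * (E k : ℝ) / (E (k + 1) : ℝ) *
          (2 * 2 ^ a k * Real.log 2 + Real.log (1 + eps0)) := by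
        gcongr
        exact log_Lb_add_two_le k
    _ = _ := by
        rw [mul_div_assoc, E_div_E_succ, h]
        field_simp
        ring

/-- The series `∑_{k=2}^∞ (4E_{k-2}/E_{k-1}) log L_k`
converges (here written with the summation index shifted by two); moreover each
summand satisfies
`(4E_{k-2}/E_{k-1}) log L_k ≤ (8 log 2)(a_{k-2})²/2^{a_{k-2}} + 4 log(1+ε₀)(a_{k-2})²/4^{a_{k-2}}`. -/
theorem summand_bound_and_summable :
    Summable (fun k : ℕ =>
      4 * (E k : ℝ) / (E (k + 1) : ℝ) * Real.log (Lb (k + 2))) ∧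
    ∀ k : ℕ, 2 ≤ k →
      4 * (E (k - 2) : ℝ) / (E (k - 1) : ℝ) * Real.log (Lb k) ≤
        8 * Real.log 2 * (a (k - 2) : ℝ) ^ 2 / 2 ^ a (k - 2) +
          4 * Real.log (1 + eps0) * (a (k - 2) : ℝ) ^ 2 / 4 ^ a (k - 2) := by
  refine ⟨?_, fun k hk => ?_⟩
  · refine Summable.of_nonneg_of_le (fun k => ?_) summand_le
      (((summable_sq_div_two_pow_a.mul_left (8 * Real.log 2)).add
        (summable_sq_div_four_pow_a.mul_left (4 * Real.log (1 + eps0)))).congr fun k => ?_)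
    · exact mul_nonneg (by positivity) (Real.log_nonneg (one_le_Lb_succ (k + 1)))
    · simp only [mul_div_assoc]
  · obtain ⟨k, rfl⟩ := Nat.exists_eq_add_of_le' hk
    exact summand_le k
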